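/- Let (f_n) ⊂ D_S be a minimizing sequence of L_S, i.e., L_S(f_n) → inf_{y ∈ D_S} L_S(y). Then there exist N ∈ ℕ and a compact subset 𝒦 ⊂ D_S of L²((0,∞)) such that f_n ∈ 𝒦 for all n > N. -/

import Mathlib

open MeasureTheory Set Filter Topology
open scoped ENNReal Topology

noncomputable section

/-- `f` lies in the normalized domain `D_S`, with `g` its (a.e.) derivative:
`f ∈ L²((0,∞))`, absolutely continuous on compact intervals (`f x = ∫₀ˣ g`),
`f' ∈ L²((0,∞))`, `ln(ω)f(ω) ∈ L²((0,∞))`, `‖f‖ = 1`, zero expected time and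
zero expected scale. -/
def InDS (f g : ℝ → ℂ) : Prop :=
  MemLp f 2 (volume : Measure ℝ) ∧
  (∀ x : ℝ, x ≤ 0 → f x = 0) ∧
  (∀ x : ℝ, IntervalIntegrable g volume 0 x) ∧
  (∀ x : ℝ, f x = ∫ t in (0:ℝ)..x, g t) ∧
  MemLp g 2 (volume.restrict (Set.Ioi (0:ℝ))) ∧
  MemLp (fun ω : ℝ => (Real.log ω : ℂ) * f ω) 2 (volume.restrict (Set.Ioi (0:ℝ))) ∧
  (∫ ω in Set.Ioi (0:ℝ), ‖f ω‖ ^ 2 = 1) ∧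
  (∫ ω in Set.Ioi (0:ℝ), Complex.I * g ω * (starRingEnd ℂ) (f ω) = 0) ∧
  (∫ ω in Set.Ioi (0:ℝ), Real.log ω * ‖f ω‖ ^ 2 = 0)

/-- The signal space uncertainty `L_S(f) = ‖T_x f‖² + ‖T_σ f‖²`, expressed via
the derivative `g` of `f`. -/
def LS (f g : ℝ → ℂ) : ℝ :=
  (∫ ω in Set.Ioi (0:ℝ), ‖g ω‖ ^ 2) + ∫ ω in Set.Ioi (0:ℝ), (Real.log ω) ^ 2 * ‖f ω‖ ^ 2


/-- Lebesgue measure on the half line. -/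
abbrev muS : Measure ℝ := volume.restrict (Set.Ioi (0:ℝ))

instance factTwoNeTop : Fact ((2:ℝ≥0∞) ≠ ∞) := ⟨by norm_num⟩

/-- Sequential weak compactness of balls in the Hilbert space `L²`. -/
lemma weak_subseq (γ : ℕ → Lp ℂ 2 muS) (C : ℝ) (h : ∀ n, ‖γ n‖ ≤ C) :
    ∃ γ' : Lp ℂ 2 muS, ∃ φ : ℕ → ℕ, StrictMono φ ∧ ‖γ'‖ ≤ C ∧
      ∀ v : Lp ℂ 2 muS, Tendsto (fun n => inner ℂ (γ (φ n)) v) atTop (𝓝 (inner ℂ γ' v)) := by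
  have key := WeakDual.isSeqCompact_closedBall (𝕜 := ℂ) (E := Lp ℂ 2 muS) 0 C
  have hx : ∀ n, StrongDual.toWeakDual (InnerProductSpace.toDual ℂ (Lp ℂ 2 muS) (γ n)) ∈
      (WeakDual.toStrongDual ⁻¹' Metric.closedBall (0 : StrongDual ℂ (Lp ℂ 2 muS)) C) := by
    intro n
    simp only [mem_preimage, mem_closedBall_zero_iff]
    exact ((InnerProductSpace.toDual ℂ (Lp ℂ 2 muS)).norm_map (γ n)).trans_le (h n)
  obtain ⟨a, ha, φ, hφ, hlim⟩ := key hx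
  refine ⟨(InnerProductSpace.toDual ℂ (Lp ℂ 2 muS)).symm (WeakDual.toStrongDual a), φ, hφ, ?_, ?_⟩
  · rw [LinearIsometryEquiv.norm_map]
    simpa using ha
  · intro v
    rw [InnerProductSpace.toDual_symm_apply]
    exact ((WeakDual.eval_continuous v).tendsto a).comp hlim

lemma muS_Ioc (x : ℝ) : muS (Ioc 0 x) = ENNReal.ofReal x := by
  rw [Measure.restrict_apply measurableSet_Ioc, inter_eq_left.2 (fun y hy => hy.1)]
  simp

lemma muS_Ioc_ne (x : ℝ) : muS (Ioc 0 x) ≠ ∞ := by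
  rw [muS_Ioc]; exact ENNReal.ofReal_ne_top

/-- the test function `1_{(0,x]}` -/
def tst (x : ℝ) : Lp ℂ 2 muS := indicatorConstLp 2 (measurableSet_Ioc (a := (0:ℝ)) (b := x)) (muS_Ioc_ne x) 1

lemma norm_tst_le {x R : ℝ} (hx : x ≤ R) : ‖tst x‖ ≤ R.toNNReal ^ (1/2 : ℝ) := by
  unfold tst
  rw [norm_indicatorConstLp (by norm_num) (by norm_num), measureReal_def, muS_Ioc]
  simp only [norm_one, one_mul, ENNReal.toReal_ofNat]
  rw [ENNReal.toReal_ofReal']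
  simp only [Real.coe_toNNReal']
  gcongr

lemma prim_eq_inner {g : ℝ → ℂ} (hg : MemLp g 2 muS) {x : ℝ} (hx : 0 ≤ x) :
    ∫ t in (0:ℝ)..x, g t = inner ℂ (tst x) (hg.toLp g) := by
  unfold tst
  rw [L2.inner_indicatorConstLp_one, intervalIntegral.integral_of_le hx]
  have h1 : muS.restrict (Ioc 0 x) = volume.restrict (Ioc 0 x) := by
    rw [Measure.restrict_restrict measurableSet_Ioc, inter_eq_left.2 (fun y hy => hy.1)]
  rw [h1]
  refine integral_congr_ae ?_
  have := hg.coeFn_toLp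
  rw [← h1]
  exact (ae_restrict_of_ae (s := Ioc 0 x) this).mono fun y hy => hy.symm

lemma inner_toLp_eq {a b : ℝ → ℂ} (ha : MemLp a 2 muS) (hb : MemLp b 2 muS) :
    inner ℂ (ha.toLp a) (hb.toLp b) = ∫ x, b x * (starRingEnd ℂ) (a x) ∂muS := by
  rw [L2.inner_def]
  refine integral_congr_ae ?_
  filter_upwards [ha.coeFn_toLp, hb.coeFn_toLp] with x h1 h2
  rw [h1, h2]; rfl

lemma sq_eq {a : ℝ → ℂ} (ha : MemLp a 2 muS) : ∫ x, ‖a x‖ ^ 2 ∂muS = ‖ha.toLp a‖ ^ 2 := by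
  have h := inner_toLp_eq ha ha
  rw [inner_self_eq_norm_sq_to_K] at h
  have : ∫ x, a x * (starRingEnd ℂ) (a x) ∂muS = ((∫ x, ‖a x‖ ^ 2 ∂muS : ℝ) : ℂ) := by
    rw [← integral_complex_ofReal]
    congr 1; ext x
    rw [Complex.mul_conj, Complex.normSq_eq_norm_sq]
  rw [this] at h
  exact Complex.ofReal_injective (by rw [← h]; push_cast; rfl)

lemma time_eq {f g : ℝ → ℂ} (hf : MemLp f 2 muS) (hg : MemLp g 2 muS) :
    ∫ ω in Set.Ioi (0:ℝ), Complex.I * g ω * (starRingEnd ℂ) (f ω)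
      = Complex.I * inner ℂ (hf.toLp f) (hg.toLp g) := by
  rw [inner_toLp_eq, ← integral_const_mul]
  simp only [mul_assoc]

lemma scale_eq {f : ℝ → ℂ} (hf : MemLp f 2 muS)
    (hl : MemLp (fun ω : ℝ => (Real.log ω : ℂ) * f ω) 2 muS) :
    ((∫ ω in Set.Ioi (0:ℝ), Real.log ω * ‖f ω‖ ^ 2 : ℝ) : ℂ)
      = inner ℂ (hf.toLp f) (hl.toLp _) := by
  rw [inner_toLp_eq, ← integral_complex_ofReal]
  congr 1; ext x
  rw [mul_assoc, Complex.mul_conj, Complex.normSq_eq_norm_sq]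
  push_cast; ring

/-- symmetry of multiplication by `log` -/
lemma scale_symm {f h : ℝ → ℂ} (hf : MemLp f 2 muS) (hh : MemLp h 2 muS)
    (hl : MemLp (fun ω : ℝ => (Real.log ω : ℂ) * f ω) 2 muS)
    (hlh : MemLp (fun ω : ℝ => (Real.log ω : ℂ) * h ω) 2 muS) :
    inner ℂ (hf.toLp f) (hlh.toLp _) = inner ℂ (hl.toLp _) (hh.toLp h) := by
  rw [inner_toLp_eq, inner_toLp_eq]
  congr 1; ext x
  simp only [map_mul, Complex.conj_ofReal]; ring

/-- Convergence in `L²` from pointwise convergence, local bounds, and log-moment bounds. -/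
lemma tendsto_of_bounds (h : ℕ → ℝ → ℂ) (hm : ∀ n, AEStronglyMeasurable (h n) muS)
    (hlim : ∀ x > 0, Tendsto (fun n => h n x) atTop (𝓝 0))
    (hloc : ∀ R : ℝ, ∃ K : ℝ, ∀ n, ∀ x, 0 < x → x ≤ R → ‖h n x‖ ≤ K)
    (M : ℝ≥0∞) (hM : M ≠ ∞)
    (hlog : ∀ n, eLpNorm (fun ω : ℝ => (Real.log ω : ℂ) * h n ω) 2 muS ≤ M) :
    Tendsto (fun n => eLpNorm (h n) 2 muS) atTop (𝓝 0) := by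
  have hsplit : ∀ T : ℝ, 0 < T → ∀ n, eLpNorm (h n) 2 muS ≤
      eLpNorm ((Iic (Real.exp T)).indicator (h n)) 2 muS + ENNReal.ofReal T⁻¹ * M := by
    intro T hT n
    have hlm : AEStronglyMeasurable (fun ω : ℝ => (Real.log ω : ℂ) * h n ω) muS :=
      (Complex.measurable_ofReal.comp Real.measurable_log).aestronglyMeasurable.mul (hm n)
    calc eLpNorm (h n) 2 muS ≤ eLpNorm (fun x => ‖(Iic (Real.exp T)).indicator (h n) x‖ +
          ‖(((T⁻¹ : ℝ) : ℂ) • (fun ω : ℝ => (Real.log ω : ℂ) * h n ω)) x‖) 2 muS := by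
          refine eLpNorm_mono fun x => ?_
          rw [Real.norm_of_nonneg (by positivity)]
          by_cases hx : x ∈ Iic (Real.exp T)
          · rw [indicator_of_mem hx]
            linarith [norm_nonneg ((((T⁻¹ : ℝ) : ℂ) • (fun ω : ℝ => (Real.log ω : ℂ) * h n ω)) x)]
          · rw [indicator_of_notMem hx]
            have hx' : Real.exp T < x := not_le.1 hx
            have hl : T < Real.log x := (Real.lt_log_iff_exp_lt ((Real.exp_pos T).trans hx')).2 hx'
            simp only [Pi.smul_apply, smul_eq_mul, norm_mul, Complex.norm_real, norm_zero, zero_add,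
              Real.norm_eq_abs]
            rw [abs_of_pos (inv_pos.2 hT), abs_of_pos (hT.trans hl), ← mul_assoc]
            have : 1 ≤ T⁻¹ * Real.log x := by
              rw [inv_mul_eq_div, one_le_div hT]; exact hl.le
            nlinarith [norm_nonneg (h n x)]
      _ ≤ eLpNorm (fun x => ‖(Iic (Real.exp T)).indicator (h n) x‖) 2 muS + eLpNorm (fun x =>
          ‖(((T⁻¹ : ℝ) : ℂ) • (fun ω : ℝ => (Real.log ω : ℂ) * h n ω)) x‖) 2 muS :=
          eLpNorm_add_le ((hm n).indicator measurableSet_Iic).norm (hlm.const_smul _).norm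
            (by norm_num)
      _ ≤ _ := by
          rw [eLpNorm_norm, eLpNorm_norm, eLpNorm_const_smul]
          gcongr
          · rw [← ofReal_norm, Complex.norm_real, Real.norm_of_nonneg (by positivity)]
          · exact hlog n
  have hfin : ∀ R : ℝ, Tendsto (fun n => eLpNorm ((Iic R).indicator (h n)) 2 muS) atTop (𝓝 0) := by
    intro R
    obtain ⟨K, hK⟩ := hloc R
    simp_rw [eLpNorm_indicator_eq_eLpNorm_restrict measurableSet_Iic]
    have hr : muS.restrict (Iic R) = volume.restrict (Ioc 0 R) := by
      rw [Measure.restrict_restrict measurableSet_Iic]; congr 1; ext x; simp [and_comm]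
    simp_rw [hr]
    simp_rw [eLpNorm_eq_lintegral_rpow_enorm_toReal (p := 2) (by norm_num) (by norm_num)]
    have h0 : Tendsto (fun n => ∫⁻ x in Ioc 0 R, ‖h n x‖ₑ ^ (2:ℝ≥0∞).toReal) atTop
        (𝓝 (∫⁻ x in Ioc 0 R, 0)) := by
      refine tendsto_lintegral_of_dominated_convergence' (fun _ => ENNReal.ofReal K ^ (2:ℝ≥0∞).toReal)
        ?_ ?_ ?_ ?_
      · intro n
        have := (hm n).mono_measure (Measure.restrict_mono_set volume (Ioc_subset_Ioi_self : Ioc 0 R ⊆ Ioi 0))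
        exact this.enorm.pow_const _
      · intro n
        filter_upwards [ae_restrict_mem measurableSet_Ioc] with x hx
        gcongr
        rw [← ofReal_norm]
        exact ENNReal.ofReal_le_ofReal (hK n x hx.1 hx.2)
      · rw [lintegral_const]
        simp [ENNReal.mul_eq_top]
      · filter_upwards [ae_restrict_mem measurableSet_Ioc] with x hx
        have h1 := (hlim x hx.1).enorm
        have h2 := (ENNReal.continuous_rpow_const (y := (2:ℝ≥0∞).toReal)).tendsto _ |>.comp h1
        simpa [Function.comp_def] using h2
    have h2 := (ENNReal.continuous_rpow_const (y := 1 / (2:ℝ≥0∞).toReal)).tendsto _ |>.comp h0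
    simpa [Function.comp_def] using h2
  rw [ENNReal.tendsto_nhds_zero]
  intro ε hε
  have hT : Tendsto (fun T : ℝ => ENNReal.ofReal T⁻¹ * M) atTop (𝓝 0) := by
    have h1 := ENNReal.tendsto_ofReal (tendsto_inv_atTop_zero (𝕜 := ℝ))
    have := ENNReal.Tendsto.mul_const h1 (Or.inr hM)
    simpa using this
  have hε2 : 0 < ε / 2 := ENNReal.half_pos hε.ne'
  obtain ⟨T, hT0, hT1⟩ := ((eventually_gt_atTop (0:ℝ)).and
    ((ENNReal.tendsto_nhds_zero.1 hT) _ hε2)).exists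
  filter_upwards [ENNReal.tendsto_nhds_zero.1 (hfin (Real.exp T)) _ hε2] with n hn
  calc _ ≤ _ := hsplit T hT0 n
    _ ≤ ε / 2 + ε / 2 := add_le_add hn hT1
    _ = ε := ENNReal.add_halves ε

lemma weak_strong {γ φ : ℕ → Lp ℂ 2 muS} {γ' φ' : Lp ℂ 2 muS} {C : ℝ} (hC : ∀ n, ‖γ n‖ ≤ C)
    (hφ : Tendsto φ atTop (𝓝 φ'))
    (hw : Tendsto (fun n => inner ℂ (γ n) φ') atTop (𝓝 (inner ℂ γ' φ'))) :
    Tendsto (fun n => inner ℂ (γ n) (φ n)) atTop (𝓝 (inner ℂ γ' φ')) := by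
  have h1 : Tendsto (fun n => inner ℂ (γ n) (φ n - φ')) atTop (𝓝 0) := by
    have h2 : Tendsto (fun n => C * ‖φ n - φ'‖) atTop (𝓝 0) := by
      simpa using (tendsto_iff_norm_sub_tendsto_zero.1 hφ).const_mul C
    refine squeeze_zero_norm (fun n => ?_) h2
    exact (norm_inner_le_norm _ _).trans (by gcongr; exact hC n)
  have h3 := h1.add hw
  simpa [← inner_add_right] using h3

lemma eLpNorm_muS_eq {f : ℝ → ℂ} (h : ∀ x ≤ 0, f x = 0) :
    eLpNorm f 2 muS = eLpNorm f 2 volume := by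
  rw [← eLpNorm_indicator_eq_eLpNorm_restrict measurableSet_Ioi]
  congr 1
  rw [indicator_eq_self]
  intro x hx
  by_contra hx'
  exact hx (h x (not_lt.1 hx'))

lemma norm_toLp_le {g : ℝ → ℂ} (hg : MemLp g 2 muS) {C : ℝ} (hC : 0 ≤ C) :
    ‖hg.toLp g‖ ≤ C ↔ eLpNorm g 2 muS ≤ ENNReal.ofReal C := by
  rw [Lp.norm_toLp, ENNReal.le_ofReal_iff_toReal_le hg.eLpNorm_ne_top hC]

/-- The compact set. -/
def KS (C : ℝ) : Set (Lp ℂ 2 (volume : Measure ℝ)) :=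
  {G | ∃ f g : ℝ → ℂ, (⇑G =ᵐ[volume] f) ∧ InDS f g ∧ eLpNorm g 2 muS ≤ ENNReal.ofReal C ∧
    eLpNorm (fun ω : ℝ => (Real.log ω : ℂ) * f ω) 2 muS ≤ ENNReal.ofReal C}

lemma isCompact_KS {C : ℝ} (hC : 0 ≤ C) : IsCompact (KS C) := by
  rw [isCompact_iff_isSeqCompact]
  intro G hG
  choose f g hGf hD hgC hlC using hG
  have hfv : ∀ n, MemLp (f n) 2 volume := fun n => (hD n).1
  have hf0 : ∀ n, ∀ x ≤ 0, f n x = 0 := fun n => (hD n).2.1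
  have hfg : ∀ n x, f n x = ∫ t in (0:ℝ)..x, g n t := fun n => (hD n).2.2.2.1
  have hg : ∀ n, MemLp (g n) 2 muS := fun n => (hD n).2.2.2.2.1
  have hl : ∀ n, MemLp (fun ω : ℝ => (Real.log ω : ℂ) * f n ω) 2 muS :=
    fun n => (hD n).2.2.2.2.2.1
  have hone : ∀ n, ∫ ω in Set.Ioi (0:ℝ), ‖f n ω‖ ^ 2 = 1 := fun n => (hD n).2.2.2.2.2.2.1
  have htime := fun n => (hD n).2.2.2.2.2.2.2.1
  have hscale := fun n => (hD n).2.2.2.2.2.2.2.2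
  have hf : ∀ n, MemLp (f n) 2 muS := fun n => (hfv n).restrict _
  have hγC : ∀ n, ‖(hg n).toLp (g n)‖ ≤ C := fun n => (norm_toLp_le (hg n) hC).2 (hgC n)
  have hψC : ∀ n, ‖(hl n).toLp _‖ ≤ C := fun n => (norm_toLp_le (hl n) hC).2 (hlC n)
  obtain ⟨γ', φ, hφ, hγ'C, hweak⟩ := weak_subseq (fun n => (hg n).toLp (g n)) C hγC
  -- the limit derivative and function
  set g' : ℝ → ℂ := (Ioi (0:ℝ)).indicator γ' with hg'def
  have hae : ⇑γ' =ᵐ[muS] g' := by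
    filter_upwards [ae_restrict_mem measurableSet_Ioi] with x hx
    rw [hg'def, indicator_of_mem hx]
  have hg' : MemLp g' 2 muS := (Lp.memLp γ').ae_eq hae
  have hg'v : MemLp g' 2 volume := by
    rw [hg'def, memLp_indicator_iff_restrict measurableSet_Ioi]
    exact Lp.memLp γ'
  have hγ' : hg'.toLp g' = γ' := by
    refine Lp.ext ?_
    exact hg'.coeFn_toLp.trans hae.symm
  have hint : ∀ a b, IntervalIntegrable g' volume a b := fun a b =>
    ((hg'v.locallyIntegrable (by norm_num)).integrableOn_isCompact isCompact_uIcc).intervalIntegrable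
  set f' : ℝ → ℂ := fun x => ∫ t in (0:ℝ)..x, g' t with hf'def
  have hf'c : Continuous f' := intervalIntegral.continuous_primitive hint 0
  have hf'0 : ∀ x ≤ 0, f' x = 0 := by
    intro x hx
    simp only [hf'def]
    rw [intervalIntegral.integral_of_ge hx, setIntegral_eq_zero_of_forall_eq_zero, neg_zero]
    intro t ht
    exact indicator_of_notMem (not_lt.2 ht.2) _
  have hf'i : ∀ x, 0 ≤ x → f' x = inner ℂ (tst x) γ' := by
    intro x hx
    rw [← hγ']; exact prim_eq_inner hg' hx
  have hfi : ∀ n x, 0 ≤ x → f n x = inner ℂ (tst x) ((hg n).toLp (g n)) := by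
    intro n x hx
    rw [hfg]; exact prim_eq_inner (hg n) hx
  have hpt : ∀ x, Tendsto (fun n => f (φ n) x) atTop (𝓝 (f' x)) := by
    intro x
    rcases le_total x 0 with hx | hx
    · simp [hf0 _ x hx, hf'0 x hx]
    · rw [hf'i x hx]
      simp_rw [hfi _ x hx]
      have := (Complex.continuous_conj.tendsto _).comp (hweak (tst x))
      simpa [Function.comp_def, inner_conj_symm] using this
  have hf'm : AEStronglyMeasurable f' muS := hf'c.aestronglyMeasurable
  have hφ1 : ∀ n, ‖(hf n).toLp (f n)‖ = 1 := by
    intro n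
    have := (sq_eq (hf n)).symm.trans (hone n)
    exact (pow_eq_one_iff_of_nonneg (norm_nonneg _) two_ne_zero).1 this
  have hf'1 : eLpNorm f' 2 muS ≤ ENNReal.ofReal 1 := by
    refine (Lp.eLpNorm_lim_le_liminf_eLpNorm (fun n => (hf (φ n)).1) f'
      (Eventually.of_forall hpt)).trans ?_
    refine liminf_le_of_le (by isBoundedDefault) (fun b hb => ?_)
    obtain ⟨n, hn⟩ := hb.exists
    exact hn.trans ((norm_toLp_le (hf (φ n)) zero_le_one).1 (hφ1 _).le)
  have hf' : MemLp f' 2 muS := ⟨hf'm, hf'1.trans_lt ENNReal.ofReal_lt_top⟩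
  have hf'v : MemLp f' 2 volume :=
    ⟨hf'c.aestronglyMeasurable, by rw [← eLpNorm_muS_eq hf'0]; exact hf'.2⟩
  have hl'C : eLpNorm (fun ω : ℝ => (Real.log ω : ℂ) * f' ω) 2 muS ≤ ENNReal.ofReal C := by
    refine (Lp.eLpNorm_lim_le_liminf_eLpNorm (fun n => (hl (φ n)).1) _
      (Eventually.of_forall fun x => (hpt x).const_mul _)).trans ?_
    refine liminf_le_of_le (by isBoundedDefault) (fun b hb => ?_)
    obtain ⟨n, hn⟩ := hb.exists
    exact hn.trans (hlC _)
  have hl' : MemLp (fun ω : ℝ => (Real.log ω : ℂ) * f' ω) 2 muS :=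
    ⟨(Complex.measurable_ofReal.comp Real.measurable_log).aestronglyMeasurable.mul hf'm,
      hl'C.trans_lt ENNReal.ofReal_lt_top⟩
  have hstrong : Tendsto (fun n => eLpNorm (f (φ n) - f') 2 muS) atTop (𝓝 0) := by
    refine tendsto_of_bounds (fun n => f (φ n) - f') (fun n => (hf _).1.sub hf'm) ?_ ?_
      (ENNReal.ofReal C + ENNReal.ofReal C) (by simp) ?_
    · intro x _
      simpa using (hpt x).sub_const (f' x)
    · intro R
      refine ⟨R.toNNReal ^ (1/2 : ℝ) * C + R.toNNReal ^ (1/2 : ℝ) * C, fun n x hx hxR => ?_⟩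
      refine (norm_sub_le _ _).trans (add_le_add ?_ ?_)
      · rw [hfi _ x hx.le]
        exact (norm_inner_le_norm _ _).trans
          (mul_le_mul (norm_tst_le hxR) (hγC _) (norm_nonneg _) (by positivity))
      · rw [hf'i x hx.le]
        exact (norm_inner_le_norm _ _).trans
          (mul_le_mul (norm_tst_le hxR) hγ'C (norm_nonneg _) (by positivity))
    · intro n
      have : (fun ω : ℝ => (Real.log ω : ℂ) * (f (φ n) - f') ω) =
          (fun ω : ℝ => (Real.log ω : ℂ) * f (φ n) ω) - (fun ω : ℝ => (Real.log ω : ℂ) * f' ω) := by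
        ext x; simp [mul_sub]
      rw [this]
      exact (eLpNorm_sub_le (hl _).1 hl'.1 (by norm_num)).trans (add_le_add (hlC _) hl'C)
  have hφlim : Tendsto (fun n => (hf (φ n)).toLp (f (φ n))) atTop (𝓝 (hf'.toLp f')) :=
    (Lp.tendsto_Lp_iff_tendsto_eLpNorm'' (fun n => f (φ n)) (fun n => hf (φ n)) f' hf').2 hstrong
  -- the constraints pass to the limit
  have c1 : ∫ ω in Set.Ioi (0:ℝ), ‖f' ω‖ ^ 2 = 1 := by
    have h1 : ‖hf'.toLp f'‖ = 1 := by
      refine tendsto_nhds_unique hφlim.norm ?_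
      simp [hφ1]
    have := sq_eq hf'
    rw [h1] at this
    simpa using this
  have c2 : ∫ ω in Set.Ioi (0:ℝ), Complex.I * g' ω * (starRingEnd ℂ) (f' ω) = 0 := by
    have h1 := weak_strong (fun n => hγC (φ n)) hφlim (hweak _)
    have h2 : ∀ n, inner ℂ ((hg n).toLp (g n)) ((hf n).toLp (f n)) = 0 := by
      intro n
      have h3 := htime n
      rw [time_eq (hf n) (hg n)] at h3
      exact inner_eq_zero_symm.1 ((mul_eq_zero.1 h3).resolve_left Complex.I_ne_zero)
    simp_rw [h2] at h1
    have h4 := tendsto_nhds_unique h1 tendsto_const_nhds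
    rw [time_eq hf' hg', hγ', inner_eq_zero_symm.1 h4, mul_zero]
  have c3 : ∫ ω in Set.Ioi (0:ℝ), Real.log ω * ‖f' ω‖ ^ 2 = 0 := by
    have h0 : Tendsto (fun n => inner ℂ ((hl (φ n)).toLp _) (hf'.toLp f')) atTop
        (𝓝 (inner ℂ (hl'.toLp _) (hf'.toLp f'))) := by
      rw [← scale_symm hf' hf' hl' hl']
      simp_rw [← scale_symm (hf _) hf' (hl _) hl']
      exact hφlim.inner tendsto_const_nhds
    have h1 := weak_strong (fun n => hψC (φ n)) hφlim h0
    have h2 : ∀ n, inner ℂ ((hl n).toLp _) ((hf n).toLp (f n)) = 0 := by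
      intro n
      rw [← scale_symm (hf n) (hf n) (hl n) (hl n), ← scale_eq (hf n) (hl n), hscale n]
      simp
    simp_rw [h2] at h1
    have h4 := tendsto_nhds_unique h1 tendsto_const_nhds
    rw [← scale_symm hf' hf' hl' hl', ← scale_eq hf' hl'] at h4
    exact_mod_cast h4
  refine ⟨hf'v.toLp f', ⟨f', g', hf'v.coeFn_toLp, ⟨hf'v, hf'0, fun x => hint 0 x, fun x => rfl,
    hg', hl', c1, c2, c3⟩, ?_, hl'C⟩, φ, hφ, ?_⟩
  · rw [← norm_toLp_le hg' hC, hγ']; exact hγ'C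
  · rw [Lp.tendsto_Lp_iff_tendsto_eLpNorm]
    refine hstrong.congr fun n => ?_
    rw [eLpNorm_muS_eq (fun x hx => by simp [hf0 _ x hx, hf'0 x hx])]
    refine eLpNorm_congr_ae ?_
    filter_upwards [hGf (φ n)] with x hx
    simp [hx]

/-- A minimizing sequence of `L_S` in `D_S` is, from some index on, contained in a
compact subset `𝒦 ⊆ D_S` of `L²((0,∞))`. -/
theorem minimizing_sequence_in_compact
    (F : ℕ → Lp ℂ 2 (volume : Measure ℝ)) (f g : ℕ → ℝ → ℂ)
    (hrep : ∀ n, ⇑(F n) =ᵐ[volume] f n)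
    (hmem : ∀ n, InDS (f n) (g n))
    (hmin : Tendsto (fun n => LS (f n) (g n)) atTop
      (𝓝 (sInf {c : ℝ | ∃ f' g' : ℝ → ℂ, InDS f' g' ∧ LS f' g' = c}))) :
    ∃ N : ℕ, ∃ 𝒦 : Set (Lp ℂ 2 (volume : Measure ℝ)), IsCompact 𝒦 ∧
      (∀ G ∈ 𝒦, ∃ f' g' : ℝ → ℂ, (⇑G =ᵐ[volume] f') ∧ InDS f' g') ∧
      ∀ n > N, F n ∈ 𝒦 := by
  obtain ⟨B, hB⟩ := hmin.bddAbove_range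
  have hB' : ∀ n, LS (f n) (g n) ≤ B := fun n => hB ⟨n, rfl⟩
  have hC : 0 ≤ |B| + 1 := by positivity
  refine ⟨0, KS (|B| + 1), isCompact_KS hC, ?_, ?_⟩
  · rintro G ⟨f', g', h1, h2, -⟩
    exact ⟨f', g', h1, h2⟩
  · intro n _
    have hg : MemLp (g n) 2 muS := (hmem n).2.2.2.2.1
    have hl : MemLp (fun ω : ℝ => (Real.log ω : ℂ) * f n ω) 2 muS := (hmem n).2.2.2.2.2.1
    have h1 := hB' n
    unfold LS at h1
    have h2 : ∫ ω in Set.Ioi (0:ℝ), (Real.log ω) ^ 2 * ‖f n ω‖ ^ 2 = ‖hl.toLp _‖ ^ 2 := by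
      rw [← sq_eq hl]
      congr 1; ext x
      simp [mul_pow]
    rw [h2, sq_eq hg] at h1
    have h3 := le_abs_self B
    have h4 := abs_nonneg B
    refine ⟨f n, g n, hrep n, hmem n, ?_, ?_⟩
    · rw [← norm_toLp_le hg hC]
      refine abs_le_of_sq_le_sq' ?_ hC |>.2
      nlinarith [sq_nonneg ‖hl.toLp _‖]
    · rw [← norm_toLp_le hl hC]
      refine abs_le_of_sq_le_sq' ?_ hC |>.2
      nlinarith [sq_nonneg ‖hg.toLp _‖]
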